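/- arXiv:1405.0463 — 4 statements merged into one kernel-verified Lean document; each statement's English description precedes it below -/
import Mathlib

section
/- Let G be a group, H a subgroup of G of index 2 (hence normal in G), k an algebraically closed field, and ξ : H → kˣ a group homomorphism such that ξ(g h g⁻¹) = ξ(h) for all g ∈ G and h ∈ H. Then ξ extends to a group homomorphism G → kˣ; moreover, the number of group homomorphisms ξ̃ : G → kˣ with ξ̃|_H = ξ is exactly 2 if the characteristic of k is not 2, and exactly 1 if the characteristic of k is 2. -/
/-- A conjugation-invariant homomorphism from an index-two subgroup to a commutative group
extends to the whole group, with value `z` at a given `s ∉ H`, as soon as `z ^ 2 = ξ (s ^ 2)`. -/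
theorem MonoidHom.exists_extension_of_index_two {G A : Type*} [Group G] [CommGroup A]
    {H : Subgroup G} (hidx : H.index = 2) (ξ : H →* A)
    (hconj : ∀ (g : G) (h : H) (hm : g * ↑h * g⁻¹ ∈ H), ξ ⟨g * ↑h * g⁻¹, hm⟩ = ξ h)
    {s : G} (hs : s ∉ H) (z : A) (hz : z ^ 2 = ξ ⟨s ^ 2, H.sq_mem_of_index_two hidx s⟩) :
    ∃ ξt : G →* A, (∀ h : H, ξt ↑h = ξ h) ∧ ξt s = z := by
  classical
  have hn : H.Normal := Subgroup.normal_of_index_eq_two hidx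
  let x : G → A := fun g ↦ if hg : g ∈ H then ξ ⟨g, hg⟩ else 1
  have hx {g : G} (hg : g ∈ H) : x g = ξ ⟨g, hg⟩ := dif_pos hg
  have hx_mul {a b : G} (ha : a ∈ H) (hb : b ∈ H) : x (a * b) = x a * x b := by
    rw [hx ha, hx hb, hx (mul_mem ha hb), ← map_mul]; rfl
  have hx_conj (g : G) {a : G} (ha : a ∈ H) : x (g * a * g⁻¹) = x a := by
    rw [hx ha, hx (hn.conj_mem a ha g)]; exact hconj g ⟨a, ha⟩ _
  have hs2 : s ^ 2 ∈ H := H.sq_mem_of_index_two hidx s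
  have hxz : x (s ^ 2) = z * z := by rw [hx hs2, ← hz, sq]
  have hmem {g : G} (hg : g ∉ H) : ∃ a ∈ H, g = s * a :=
    ⟨s⁻¹ * g, by simp [Subgroup.mul_mem_iff_of_index_two hidx, hs, hg], by group⟩
  let f : G → A := fun g ↦ if g ∈ H then x g else z * x (s⁻¹ * g)
  have hf {a : G} (ha : a ∈ H) : f a = x a := if_pos ha
  have hfs {a : G} (ha : a ∈ H) : f (s * a) = z * x a := by
    have h : s * a ∉ H := by simp [Subgroup.mul_mem_iff_of_index_two hidx, hs, ha]
    simp only [f, if_neg h, inv_mul_cancel_left]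
  have hf_mul (g g' : G) : f (g * g') = f g * f g' := by
    by_cases hg : g ∈ H <;> by_cases hg' : g' ∈ H
    · rw [hf (mul_mem hg hg'), hf hg, hf hg', hx_mul hg hg']
    · obtain ⟨b, hb, rfl⟩ := hmem hg'
      have hc := hn.conj_mem g hg s⁻¹
      rw [show g * (s * b) = s * ((s⁻¹ * g * s⁻¹⁻¹) * b) by group, hfs (mul_mem hc hb),
        hx_mul hc hb, hx_conj _ hg, hf hg, hfs hb, mul_left_comm]
    · obtain ⟨a, ha, rfl⟩ := hmem hg
      rw [mul_assoc, hfs (mul_mem ha hg'), hx_mul ha hg', hfs ha, hf hg', mul_assoc]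
    · obtain ⟨a, ha, rfl⟩ := hmem hg
      obtain ⟨b, hb, rfl⟩ := hmem hg'
      have hc := hn.conj_mem a ha s
      rw [show s * a * (s * b) = s * a * s⁻¹ * (s ^ 2 * b) by group,
        hf (mul_mem hc (mul_mem hs2 hb)), hx_mul hc (mul_mem hs2 hb), hx_mul hs2 hb,
        hx_conj _ ha, hfs ha, hfs hb, hxz]
      simp only [mul_assoc, mul_left_comm]
  refine ⟨MonoidHom.mk' f hf_mul, fun h ↦ ?_, ?_⟩
  · exact (hf h.2).trans (hx h.2)
  · have h := hfs H.one_mem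
    rw [mul_one, hx H.one_mem] at h
    exact h.trans (by rw [show (⟨1, H.one_mem⟩ : H) = 1 from rfl, map_one, mul_one])

/-- Evaluation at `s ∉ H` identifies the extensions of `ξ` with the square roots
of `ξ (s ^ 2)`. -/
theorem MonoidHom.card_extension_of_index_two {G A : Type*} [Group G] [CommGroup A]
    {H : Subgroup G} (hidx : H.index = 2) (ξ : H →* A)
    (hconj : ∀ (g : G) (h : H) (hm : g * ↑h * g⁻¹ ∈ H), ξ ⟨g * ↑h * g⁻¹, hm⟩ = ξ h)
    {s : G} (hs : s ∉ H) :
    Nat.card {ξt : G →* A // ∀ h : H, ξt ↑h = ξ h} =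
      Nat.card {z : A // z ^ 2 = ξ ⟨s ^ 2, H.sq_mem_of_index_two hidx s⟩} := by
  refine Nat.card_eq_of_bijective
    (fun ξt ↦ ⟨ξt.1 s, by rw [← map_pow]; exact ξt.2 ⟨s ^ 2, _⟩⟩) ⟨?_, ?_⟩
  · rintro ⟨φ, hφ⟩ ⟨ψ, hψ⟩ h
    have h : φ s = ψ s := congrArg Subtype.val h
    refine Subtype.ext (MonoidHom.ext fun g ↦ ?_)
    by_cases hg : g ∈ H
    · exact (hφ ⟨g, hg⟩).trans (hψ ⟨g, hg⟩).symm
    · have ha : s⁻¹ * g ∈ H := by simp [Subgroup.mul_mem_iff_of_index_two hidx, hs, hg]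
      have key : φ (s⁻¹ * g) = ψ (s⁻¹ * g) := (hφ ⟨_, ha⟩).trans (hψ ⟨_, ha⟩).symm
      rwa [map_mul, map_mul, map_inv, map_inv, h, mul_right_inj] at key
  · rintro ⟨z, hz⟩
    obtain ⟨ξt, h, hsz⟩ := exists_extension_of_index_two hidx ξ hconj hs z hz
    exact ⟨⟨ξt, h⟩, Subtype.ext hsz⟩


/-- Let `G` be a group, `H` a subgroup of index 2 (hence normal), `k` an algebraically
closed field, and `ξ : H → kˣ` a homomorphism invariant under conjugation by `G`.
Then `ξ` extends to a homomorphism `G → kˣ`, and the number of such extensions is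
exactly `2` if `char k ≠ 2` and exactly `1` if `char k = 2`. -/
theorem stmt0 {G : Type*} [Group G] (H : Subgroup G) (hidx : H.index = 2)
    (k : Type*) [Field k] [IsAlgClosed k] (ξ : H →* kˣ)
    (hconj : ∀ (g : G) (h : H) (hm : g * ↑h * g⁻¹ ∈ H),
      ξ ⟨g * ↑h * g⁻¹, hm⟩ = ξ h) :
    (∃ ξt : G →* kˣ, ∀ h : H, ξt ↑h = ξ h) ∧
    (ringChar k ≠ 2 → Nat.card {ξt : G →* kˣ // ∀ h : H, ξt ↑h = ξ h} = 2) ∧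
    (ringChar k = 2 → Nat.card {ξt : G →* kˣ // ∀ h : H, ξt ↑h = ξ h} = 1) := by
  obtain ⟨s, hs⟩ : ∃ s, s ∉ H := by
    by_contra! h
    rw [(Subgroup.eq_top_iff' H).2 h, Subgroup.index_top] at hidx
    exact absurd hidx (by decide)
  rw [MonoidHom.card_extension_of_index_two hidx ξ hconj hs]
  set c := ξ ⟨s ^ 2, H.sq_mem_of_index_two hidx s⟩
  obtain ⟨z, hz⟩ : ∃ z : kˣ, z ^ 2 = c := by
    obtain ⟨w, hw⟩ := IsAlgClosed.exists_pow_nat_eq (c : k) two_pos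
    have hw0 : w ≠ 0 := by
      rintro rfl
      exact c.ne_zero (by simpa using hw.symm)
    exact ⟨Units.mk0 w hw0, Units.ext (by simpa using hw)⟩
  have hroots : {y : kˣ | y ^ 2 = c} = {z, -z} := by
    ext y
    simp [← hz, Units.ext_iff, sq_eq_sq_iff_eq_or_eq_neg]
  have hcard : Nat.card {y : kˣ // y ^ 2 = c} = ({z, -z} : Set kˣ).ncard := by
    rw [← hroots]; rfl
  rw [hcard]
  refine ⟨?_, fun h2 ↦ Set.ncard_pair fun h ↦ ?_, fun h2 ↦ ?_⟩
  · obtain ⟨ξt, h, -⟩ := MonoidHom.exists_extension_of_index_two hidx ξ hconj hs z hz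
    exact ⟨ξt, h⟩
  · refine z.ne_zero ((Ring.eq_self_iff_eq_zero_of_char_ne_two h2).1 ?_)
    simpa using (congrArg Units.val h).symm
  · have : CharP k 2 := ringChar.of_eq h2
    have h : -z = z := Units.ext (by simp [CharTwo.neg_eq])
    rw [h, Set.pair_eq_singleton, Set.ncard_singleton]
end

section
/- Let G be a group, H a subgroup of G of index 2, k an algebraically closed field, ξ : H → kˣ a group homomorphism, and g ∈ G ∖ H. The two-dimensional induced representation Ind_H^G ξ is irreducible (has no nonzero proper G-invariant subspace) if and only if there exists h ∈ H with ξ(g h g⁻¹) ≠ ξ(h). -/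
section IndDef

variable {G : Type*} [Group G] (H : Subgroup G) (k : Type*) [Field k] (ξ : H →* kˣ)

/-- The space of the induced representation of the character `ξ` from `H` to `G`:
functions `f : G → k` with `f (h * g) = ξ h * f g`. -/
def indCar : Submodule k (G → k) where
  carrier := {f | ∀ (h : H) (g : G), f (↑h * g) = (ξ h : k) * f g}
  add_mem' := by
    intro a b ha hb h g
    simp only [Set.mem_setOf_eq, Pi.add_apply] at *
    rw [ha h g, hb h g]; ring
  zero_mem' := by intro h g; simp
  smul_mem' := by
    intro c f hf h g
    simp only [Set.mem_setOf_eq, Pi.smul_apply, smul_eq_mul] at *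
    rw [hf h g]; ring

/-- The induced representation `Ind_H^G ξ`, with `G` acting by right translation:
`(g • f) x = f (x * g)`. -/
def indRep : Representation k G (indCar H k ξ) where
  toFun g :=
    { toFun := fun f => ⟨fun x => (f : G → k) (x * g), by
        intro h x
        simpa [mul_assoc] using f.2 h (x * g)⟩
      map_add' := by intro f₁ f₂; apply Subtype.ext; funext x; simp
      map_smul' := by intro c f; apply Subtype.ext; funext x; simp }
  map_one' := by
    apply LinearMap.ext; intro f; apply Subtype.ext; funext x; simp
  map_mul' := by
    intro g₁ g₂
    apply LinearMap.ext; intro f; apply Subtype.ext; funext x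
    simp [mul_assoc]

/-- Isomorphism of representations. -/
def RepIso {M : Type*} [Monoid M] {k : Type*} [CommSemiring k] {V W : Type*}
    [AddCommMonoid V] [Module k V] [AddCommMonoid W] [Module k W]
    (ρ : Representation k M V) (τ : Representation k M W) : Prop :=
  ∃ e : V ≃ₗ[k] W, ∀ (g : M) (v : V), e (ρ g v) = τ g (e v)

/-- Irreducibility of a representation: the space is nonzero and the only invariant
subspaces are `⊥` and `⊤`. -/
def IsIrredRep {M : Type*} [Monoid M] {k : Type*} [CommSemiring k] {V : Type*}
    [AddCommMonoid V] [Module k V] (ρ : Representation k M V) : Prop :=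
  Nontrivial V ∧ ∀ W : Submodule k V, (∀ g : M, ∀ v ∈ W, ρ g v ∈ W) → W = ⊥ ∨ W = ⊤

/-- The conjugate character `ξ^g : h ↦ ξ (g * h * g⁻¹)` of a normal subgroup. -/
def conjChar [H.Normal] (g : G) : H →* kˣ :=
  ξ.comp (MulAut.conjNormal g).toMonoidHom

theorem conjChar_apply [H.Normal] (g : G) (h : H)
    (hm : g * ↑h * g⁻¹ ∈ H) : conjChar H k ξ g h = ξ ⟨g * ↑h * g⁻¹, hm⟩ := by
  have h1 : (MulAut.conjNormal g h : H) = ⟨g * ↑h * g⁻¹, hm⟩ := by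
    ext; simp
  show ξ (MulAut.conjNormal g h) = _
  rw [h1]

end IndDef

section IndexTwo

variable {G : Type*} [Group G] {H : Subgroup G} {k : Type*} [Field k] {ξ : H →* kˣ} {g : G}

theorem mul_inv_mem_of_index_two (hidx : H.index = 2) (hg : g ∉ H) {x : G} (hx : x ∉ H) :
    x * g⁻¹ ∈ H := by
  rw [Subgroup.mul_mem_iff_of_index_two hidx, inv_mem_iff]
  exact iff_of_false hx hg

theorem indCar_apply_mul (v : indCar H k ξ) {h : G} (hh : h ∈ H) (x : G) :
    (v : G → k) (h * x) = (ξ ⟨h, hh⟩ : k) * (v : G → k) x :=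
  v.2 ⟨h, hh⟩ x

theorem indCar_apply_mem (v : indCar H k ξ) {h : G} (hh : h ∈ H) :
    (v : G → k) h = (ξ ⟨h, hh⟩ : k) * (v : G → k) 1 := by
  simpa using indCar_apply_mul v hh 1

theorem indRep_apply (x : G) (v : indCar H k ξ) (y : G) :
    (indRep H k ξ x v : G → k) y = (v : G → k) (y * x) :=
  rfl

/-- Functions in the induced representation are determined by their values at `1` and `g`. -/
theorem indCar_ext (hidx : H.index = 2) (hg : g ∉ H) {v w : indCar H k ξ}
    (h_one : (v : G → k) 1 = (w : G → k) 1) (h_g : (v : G → k) g = (w : G → k) g) : v = w := by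
  ext x
  by_cases hx : x ∈ H
  · rw [indCar_apply_mem v hx, indCar_apply_mem w hx, h_one]
  · have hxg := mul_inv_mem_of_index_two hidx hg hx
    have hv := indCar_apply_mul v hxg g
    have hw := indCar_apply_mul w hxg g
    rw [inv_mul_cancel_right] at hv hw
    rw [hv, hw, h_g]

/-- The values at `1` and `g` of a function in the induced representation are arbitrary. -/
theorem exists_indCar_apply_eq (hidx : H.index = 2) (hg : g ∉ H) (a b : k) :
    ∃ v : indCar H k ξ, (v : G → k) 1 = a ∧ (v : G → k) g = b := by
  classical
  let f : G → k := fun x =>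
    if hx : x ∈ H then (ξ ⟨x, hx⟩ : k) * a
    else (ξ ⟨x * g⁻¹, mul_inv_mem_of_index_two hidx hg hx⟩ : k) * b
  have hf : f ∈ indCar H k ξ := by
    intro h x
    by_cases hx : x ∈ H
    · have hhx : (h : G) * x ∈ H := H.mul_mem h.2 hx
      have e : (⟨h * x, hhx⟩ : H) = h * ⟨x, hx⟩ := rfl
      simp only [f, dif_pos hx, dif_pos hhx, e, map_mul, Units.val_mul, mul_assoc]
    · have hhx : (h : G) * x ∉ H := fun hm => hx ((H.mul_mem_cancel_left h.2).1 hm)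
      have e : (⟨h * x * g⁻¹, mul_inv_mem_of_index_two hidx hg hhx⟩ : H) =
          h * ⟨x * g⁻¹, mul_inv_mem_of_index_two hidx hg hx⟩ :=
        Subtype.ext (mul_assoc _ _ _)
      simp only [f, dif_neg hx, dif_neg hhx]
      rw [e, map_mul, Units.val_mul, mul_assoc]
  have e : (⟨1, H.one_mem⟩ : H) = 1 := rfl
  exact ⟨⟨f, hf⟩, by simp [f, H.one_mem, e], by simp [f, hg, e]⟩

theorem eq_top_of_mem_of_apply_one_eq_zero (hidx : H.index = 2) (hg : g ∉ H)
    {W : Submodule k (indCar H k ξ)} (hW : ∀ x : G, ∀ v ∈ W, indRep H k ξ x v ∈ W)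
    {e : indCar H k ξ} (he : e ∈ W) (h_one : (e : G → k) 1 = 0) (h_g : (e : G → k) g ≠ 0) :
    W = ⊤ := by
  have hgg : (e : G → k) (g * g) = 0 := by
    rw [indCar_apply_mem e (Subgroup.mul_self_mem_of_index_two hidx g), h_one, mul_zero]
  refine eq_top_iff.2 fun v _ => ?_
  have hv : v = ((v : G → k) 1 / (e : G → k) g) • indRep H k ξ g e +
      ((v : G → k) g / (e : G → k) g) • e := by
    apply indCar_ext hidx hg <;> simp [indRep_apply, h_one, h_g, hgg]
  rw [hv]
  exact W.add_mem (W.smul_mem _ (hW g e he)) (W.smul_mem _ he)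

/-- The subspace of functions `v` with `v g = s * v 1`. -/
def indEigenspace (H : Subgroup G) (ξ : H →* kˣ) (g : G) (s : k) :
    Submodule k (indCar H k ξ) where
  carrier := {v | (v : G → k) g = s * (v : G → k) 1}
  add_mem' := by
    intro v w hv hw
    simp only [Set.mem_ofPred_eq, Submodule.coe_add, Pi.add_apply] at *
    rw [hv, hw, mul_add]
  zero_mem' := by simp
  smul_mem' := by
    intro c v hv
    simp only [Set.mem_ofPred_eq, Submodule.coe_smul, Pi.smul_apply, smul_eq_mul] at *
    rw [hv, mul_left_comm]

theorem indCar_apply_mul_mem [hN : H.Normal] (v : indCar H k ξ) {h : G} (hh : h ∈ H) :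
    (v : G → k) (g * h) = (ξ ⟨g * h * g⁻¹, hN.conj_mem h hh g⟩ : k) * (v : G → k) g := by
  simpa using indCar_apply_mul v (hN.conj_mem h hh g) g

theorem indRep_mem_indEigenspace [hN : H.Normal] (hidx : H.index = 2) (hg : g ∉ H)
    (hξ : ∀ h : H, ξ ⟨g * ↑h * g⁻¹, hN.conj_mem ↑h h.2 g⟩ = ξ h) {s : k}
    (hs : (ξ ⟨g * g, Subgroup.mul_self_mem_of_index_two hidx g⟩ : k) = s * s) (x : G)
    {v : indCar H k ξ} (hv : v ∈ indEigenspace H ξ g s) :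
    indRep H k ξ x v ∈ indEigenspace H ξ g s := by
  change (v : G → k) g = s * (v : G → k) 1 at hv
  change (v : G → k) (g * x) = s * (v : G → k) (1 * x)
  rw [one_mul]
  by_cases hx : x ∈ H
  · rw [indCar_apply_mul_mem v hx, hξ ⟨x, hx⟩, indCar_apply_mem v hx, hv]
    ring
  · obtain ⟨h, rfl⟩ : ∃ h : H, x = h * g :=
      ⟨⟨x * g⁻¹, mul_inv_mem_of_index_two hidx hg hx⟩, by simp⟩
    have e : g * (h * g) = g * h * g⁻¹ * (g * g) := by group
    rw [e, indCar_apply_mul v (hN.conj_mem h h.2 g), hξ h,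
      indCar_apply_mem v (Subgroup.mul_self_mem_of_index_two hidx g), hs,
      indCar_apply_mul v h.2 g, hv]
    ring

end IndexTwo

/-- Let `H` be an index-2 (hence normal) subgroup of `G`, `k` an algebraically closed
field, `ξ : H → kˣ` a character and `g ∈ G ∖ H`.  The two-dimensional induced
representation `Ind_H^G ξ` is irreducible (has no nonzero proper `G`-invariant subspace)
iff `ξ (g h g⁻¹) ≠ ξ h` for some `h ∈ H`. -/
theorem stmt1 {G : Type*} [Group G] (H : Subgroup G) [hN : H.Normal] (hidx : H.index = 2)
    (k : Type*) [Field k] [IsAlgClosed k] (ξ : H →* kˣ) (g : G) (hg : g ∉ H) :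
    (∀ W : Submodule k (indCar H k ξ),
        (∀ x : G, ∀ v ∈ W, indRep H k ξ x v ∈ W) → W = ⊥ ∨ W = ⊤) ↔
      ∃ h : H, ξ ⟨g * ↑h * g⁻¹, hN.conj_mem ↑h h.2 g⟩ ≠ ξ h := by
  constructor
  · intro hirr
    by_contra! hξ
    have hgg := Subgroup.mul_self_mem_of_index_two hidx g
    obtain ⟨s, hs⟩ := IsAlgClosed.exists_eq_mul_self (ξ ⟨g * g, hgg⟩ : k)
    rcases hirr (indEigenspace H ξ g s)
      (fun x v hv => indRep_mem_indEigenspace hidx hg hξ hs x hv) with hW | hW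
    · obtain ⟨v, hv_one, hv_g⟩ := exists_indCar_apply_eq (ξ := ξ) hidx hg 1 s
      have hv : v ∈ indEigenspace H ξ g s := by
        change (v : G → k) g = s * (v : G → k) 1
        rw [hv_one, hv_g, mul_one]
      rw [hW, Submodule.mem_bot] at hv
      simp [hv] at hv_one
    · obtain ⟨v, hv_one, hv_g⟩ := exists_indCar_apply_eq (ξ := ξ) hidx hg 0 1
      have hv : v ∈ indEigenspace H ξ g s := hW ▸ Submodule.mem_top
      change (v : G → k) g = s * (v : G → k) 1 at hv
      simp [hv_one, hv_g] at hv
  · rintro ⟨h, hh⟩ W hW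
    refine or_iff_not_imp_left.2 fun hbot => ?_
    obtain ⟨w, hwW, hw⟩ := W.ne_bot_iff.1 hbot
    by_cases hwg : (w : G → k) g = 0
    · have hw_one : (w : G → k) 1 ≠ 0 := fun h_one =>
        hw (indCar_ext hidx hg (by simpa using h_one) (by simpa using hwg))
      refine eq_top_of_mem_of_apply_one_eq_zero hidx hg hW (hW g w hwW) ?_ ?_
      · simpa [indRep_apply] using hwg
      · rw [indRep_apply, indCar_apply_mem w (Subgroup.mul_self_mem_of_index_two hidx g)]
        exact mul_ne_zero (Units.ne_zero _) hw_one
    · refine eq_top_of_mem_of_apply_one_eq_zero hidx hg hW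
        (W.sub_mem (hW h w hwW) (W.smul_mem (ξ h : k) hwW)) ?_ ?_
      · simp [indRep_apply, indCar_apply_mem w h.2]
      · simp only [Submodule.coe_sub, Submodule.coe_smul, Pi.sub_apply, Pi.smul_apply,
          smul_eq_mul, indRep_apply, indCar_apply_mul_mem w h.2, ← sub_mul]
        exact mul_ne_zero (sub_ne_zero.2 fun e => hh (Units.ext e)) hwg
end

section
/- Let G be a group, H a subgroup of G of index 2, k an algebraically closed field, g ∈ G ∖ H, and ξ, ξ′ : H → kˣ group homomorphisms such that ξ is regular, i.e. ξ^g ≠ ξ. Then Ind_H^G ξ and Ind_H^G ξ′ are isomorphic as representations of G if and only if ξ′ = ξ or ξ′ = ξ^g. -/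
section Induced

variable {G : Type*} [Group G] {H : Subgroup G} {k : Type*} [Field k]

theorem conjChar_mul_left [H.Normal] (ξ : H →* kˣ) (a : H) (x : G) :
    conjChar H k ξ (↑a * x) = conjChar H k ξ x := by
  ext h
  have hc : MulAut.conjNormal (a : G) = MulAut.conj a := by
    ext; simp
  simp [conjChar, hc]

theorem conjChar_one [H.Normal] (ξ : H →* kˣ) : conjChar H k ξ 1 = ξ := by
  ext h
  simp [conjChar]

theorem conjChar_eq_of_index_two [H.Normal] (hidx : H.index = 2) (ξ : H →* kˣ) {g : G}
    (hg : g ∉ H) (x : G) : conjChar H k ξ x = ξ ∨ conjChar H k ξ x = conjChar H k ξ g := by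
  by_cases hx : x ∈ H
  · left
    simpa [conjChar_one] using conjChar_mul_left ξ ⟨x, hx⟩ 1
  · right
    have hm : x * g⁻¹ ∈ H := by
      rw [Subgroup.mul_mem_iff_of_index_two hidx, inv_mem_iff]
      exact iff_of_false hx hg
    simpa using conjChar_mul_left ξ ⟨x * g⁻¹, hm⟩ g

theorem apply_mul_left_of_mem_indCar [H.Normal] {ξ : H →* kˣ} {f : G → k}
    (hf : f ∈ indCar H k ξ) (x : G) (h : H) (y : G) :
    f (x * (h * y)) = (conjChar H k ξ x h : k) * f (x * y) := by
  have := hf (MulAut.conjNormal x h) (x * y)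
  simpa [conjChar, mul_assoc] using this

open Classical in
/-- The function in the induced representation that extends `ξ` by zero outside `H`. -/
noncomputable def extendByZero (ξ : H →* kˣ) : indCar H k ξ :=
  ⟨fun x => if hx : x ∈ H then (ξ ⟨x, hx⟩ : k) else 0, by
    intro h x
    by_cases hx : x ∈ H
    · have : (⟨h * x, mul_mem h.2 hx⟩ : H) = h * ⟨x, hx⟩ := rfl
      simp [hx, H.mul_mem_cancel_left h.2, this]
    · simp [hx, H.mul_mem_cancel_left h.2]⟩

theorem extendByZero_ne_zero (ξ : H →* kˣ) : extendByZero ξ ≠ 0 := by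
  intro h
  have h1 := congrArg (fun f : indCar H k ξ => (f : G → k) ((1 : H) : G)) h
  simp [extendByZero] at h1

theorem indRep_extendByZero (ξ : H →* kˣ) (h : H) :
    indRep H k ξ h (extendByZero ξ) = (ξ h : k) • extendByZero ξ := by
  apply Subtype.ext
  funext x
  by_cases hx : x ∈ H
  · have : (⟨x * h, mul_mem hx h.2⟩ : H) = ⟨x, hx⟩ * h := rfl
    simp [indRep, extendByZero, hx, H.mul_mem_cancel_right h.2, this, mul_comm]
  · simp [indRep, extendByZero, hx, H.mul_mem_cancel_right h.2]

/-- A nonzero eigenvector for `H` in an induced representation has a conjugate of the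
inducing character as its eigencharacter. -/
theorem exists_conjChar_eq_of_eigenvector [H.Normal] {ξ χ : H →* kˣ} {f : indCar H k ξ}
    (hf : f ≠ 0) (hχ : ∀ h : H, indRep H k ξ h f = (χ h : k) • f) :
    ∃ x : G, χ = conjChar H k ξ x := by
  obtain ⟨x, hx⟩ : ∃ x, (f : G → k) x ≠ 0 := by
    by_contra! h0
    exact hf (Subtype.ext (funext h0))
  refine ⟨x, MonoidHom.ext fun h => Units.ext ?_⟩
  have h1 : (f : G → k) (x * h) = (χ h : k) * (f : G → k) x :=
    congrArg (fun v : indCar H k ξ => (v : G → k) x) (hχ h)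
  have h2 := apply_mul_left_of_mem_indCar f.2 x h 1
  rw [mul_one, mul_one, h1] at h2
  exact mul_right_cancel₀ hx h2

theorem repIso_indRep_conjChar [H.Normal] (ξ : H →* kˣ) (g : G) :
    RepIso (indRep H k ξ) (indRep H k (conjChar H k ξ g)) := by
  refine ⟨{ toFun := fun f => ⟨fun x => (f : G → k) (g * x),
              fun h x => apply_mul_left_of_mem_indCar f.2 g h x⟩
            invFun := fun f => ⟨fun x => (f : G → k) (g⁻¹ * x), fun h x => ?_⟩
            map_add' := fun _ _ => rfl
            map_smul' := fun _ _ => rfl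
            left_inv := fun f => ?_
            right_inv := fun f => ?_ }, fun a f => ?_⟩
  · have := apply_mul_left_of_mem_indCar f.2 g⁻¹ h x
    simpa [conjChar] using this
  · apply Subtype.ext
    funext x
    simp
  · apply Subtype.ext
    funext x
    simp
  · apply Subtype.ext
    funext x
    simp [indRep, mul_assoc]

end Induced

/-- Let `H` be an index-2 (hence normal) subgroup of `G`, `k` an algebraically closed
field, `g ∈ G ∖ H`, and `ξ, ξ' : H → kˣ` characters with `ξ` regular (`ξ^g ≠ ξ`).
Then `Ind_H^G ξ ≅ Ind_H^G ξ'` as representations of `G` iff `ξ' = ξ` or `ξ' = ξ^g`. -/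
theorem stmt2 {G : Type*} [Group G] (H : Subgroup G) [hN : H.Normal] (hidx : H.index = 2)
    (k : Type*) [Field k] [IsAlgClosed k] (g : G) (hg : g ∉ H)
    (ξ ξ' : H →* kˣ) (hreg : conjChar H k ξ g ≠ ξ) :
    RepIso (indRep H k ξ) (indRep H k ξ') ↔ ξ' = ξ ∨ ξ' = conjChar H k ξ g := by
  constructor
  · rintro ⟨e, he⟩
    obtain ⟨x, rfl⟩ : ∃ x : G, ξ' = conjChar H k ξ x := by
      refine exists_conjChar_eq_of_eigenvector (f := e.symm (extendByZero ξ')) ?_ fun h => ?_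
      · simpa using extendByZero_ne_zero ξ'
      · apply e.injective
        rw [he, map_smul, e.apply_symm_apply, indRep_extendByZero]
    exact conjChar_eq_of_index_two hidx ξ hg x
  · rintro (rfl | rfl)
    · exact ⟨LinearEquiv.refl k _, fun _ _ => rfl⟩
    · exact repIso_indRep_conjChar ξ g
end

section
/- Let p be a prime, q = p^f a positive power of p, K a finite field with q² elements, Fˣ = {x ∈ Kˣ : x^q = x}, k an algebraic closure of 𝔽_p, and ω : Fˣ → kˣ a group homomorphism. Then the number of group homomorphisms ξ : Kˣ → kˣ satisfying ξ|_{Fˣ} = ω and ξ(x^q) = ξ(x) for all x ∈ Kˣ equals: 0 if p ≠ 2 and ω(−1) ≠ 1; 2 if p ≠ 2 and ω(−1) = 1; and 1 if p = 2. -/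
section Defs

variable {K : Type*} [Field K] [Fintype K] {p f q : ℕ}

theorem pow_q_mul_q (hK : Fintype.card K = q ^ 2) (x : Kˣ) : x ^ (q * q) = x := by
  have h2 : 0 < q ^ 2 := by rw [← hK]; exact Fintype.card_pos
  have hcardU : Nat.card Kˣ + 1 = q * q := by
    rw [Nat.card_units, Nat.card_eq_fintype_card, hK, ← sq, Nat.sub_add_cancel h2]
  calc x ^ (q * q) = x ^ (Nat.card Kˣ + 1) := by rw [hcardU]
    _ = x ^ Nat.card Kˣ * x := pow_succ x _
    _ = x := by rw [pow_card_eq_one', one_mul]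

theorem neg_one_pow_q (hp : p.Prime) (hf : 0 < f) (hq : q = p ^ f)
    (hK : Fintype.card K = q ^ 2) : (-1 : Kˣ) ^ q = -1 := by
  by_cases h2 : p = 2
  · have hc : ((Fintype.card K : ℕ) : K) = 0 := FiniteField.cast_card_eq_zero (K := K)
    rw [hK, hq, h2] at hc
    push_cast at hc
    have h20 : (2 : K) = 0 := by
      have h' : (2 : K) ^ (f * 2) = 0 := by rw [pow_mul]; exact hc
      exact pow_eq_zero_iff (by omega) |>.mp h'
    have hneg : (-1 : K) = 1 := by linear_combination -h20
    have hu : (-1 : Kˣ) = 1 := Units.ext (by simpa using hneg)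
    rw [hu, one_pow]
  · have hodd : Odd q := by rw [hq]; exact (hp.odd_of_ne_two h2).pow
    exact hodd.neg_one_pow

/-- The subgroup `Fˣ = {x ∈ Kˣ : x^q = x}` of `Kˣ`, i.e. the multiplicative group of
the `q`-element subfield. -/
def Fsub (q : ℕ) (K : Type*) [Field K] : Subgroup Kˣ where
  carrier := {x | x ^ q = x}
  one_mem' := one_pow q
  mul_mem' := by
    intro a b ha hb
    simp only [Set.mem_setOf_eq] at *
    rw [mul_pow, ha, hb]
  inv_mem' := by
    intro a ha
    simp only [Set.mem_setOf_eq] at *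
    rw [inv_pow, ha]

theorem mem_Fsub {K : Type*} [Field K] {x : Kˣ} : x ∈ Fsub q K ↔ x ^ q = x := Iff.rfl

theorem neg_one_mem_Fsub (hp : p.Prime) (hf : 0 < f) (hq : q = p ^ f)
    (hK : Fintype.card K = q ^ 2) : (-1 : Kˣ) ∈ Fsub q K :=
  neg_one_pow_q hp hf hq hK

end Defs

section Helpers

variable {K : Type*} [Field K] [Fintype K] {k : Type*} [Field k] {q : ℕ}

theorem units_sq_eq_sq_iff {z w : kˣ} : z ^ 2 = w ^ 2 ↔ z = w ∨ z = -w := by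
  simp only [Units.ext_iff, Units.val_pow_eq_pow_val, Units.val_neg]
  exact sq_eq_sq_iff_eq_or_eq_neg

theorem orderOf_generator (hK : Fintype.card K = q ^ 2) {g : Kˣ}
    (hg : ∀ x, x ∈ Subgroup.zpowers g) : orderOf g = (q + 1) * (q - 1) := by
  rw [orderOf_eq_card_of_forall_mem_zpowers hg, Nat.card_units, Nat.card_eq_fintype_card, hK]
  simpa using Nat.sq_sub_sq q 1

theorem generator_pow_mem_Fsub (hK : Fintype.card K = q ^ 2) (g : Kˣ) :
    g ^ (q + 1) ∈ Fsub q K := by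
  rw [mem_Fsub, ← pow_mul, add_mul, pow_add, pow_q_mul_q hK, one_mul, pow_succ']

theorem exists_eq_zpow_of_mem_Fsub (hq : 1 < q) (hK : Fintype.card K = q ^ 2) {g : Kˣ}
    (hg : ∀ x, x ∈ Subgroup.zpowers g) {x : Kˣ} (hx : x ∈ Fsub q K) :
    ∃ n : ℤ, x = (g ^ (q + 1)) ^ n := by
  obtain ⟨n, rfl⟩ := Subgroup.mem_zpowers_iff.mp (hg x)
  obtain ⟨m, rfl⟩ : ∃ m, q = m + 1 := ⟨q - 1, by omega⟩
  have h1 : g ^ (n * (m : ℤ)) = 1 := by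
    rw [mem_Fsub, pow_succ, mul_eq_right] at hx
    rwa [zpow_mul, zpow_natCast]
  have h2 := orderOf_dvd_iff_zpow_eq_one.mpr h1
  rw [orderOf_generator hK hg] at h2
  push_cast [Nat.add_sub_cancel] at h2
  obtain ⟨t, ht⟩ := Int.dvd_of_mul_dvd_mul_right (by omega : (m : ℤ) ≠ 0) h2
  refine ⟨t, ?_⟩
  rw [← zpow_natCast g, ← zpow_mul, ht]
  push_cast
  rfl

/-- Irregular extensions of `ω` correspond to the possible values at a generator `g` of `Kˣ`. -/
theorem card_irregular_extensions (hq : 1 < q) (hK : Fintype.card K = q ^ 2) {g : Kˣ}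
    (hg : ∀ x, x ∈ Subgroup.zpowers g) (ω : Fsub q K →* kˣ) :
    Nat.card {ξ : Kˣ →* kˣ // (∀ x : Fsub q K, ξ ↑x = ω x) ∧ ∀ x : Kˣ, ξ (x ^ q) = ξ x} =
      Nat.card {z : kˣ // z ^ 2 = ω ⟨g ^ (q + 1), generator_pow_mem_Fsub hK g⟩ ∧
        z ^ (q - 1) = 1} := by
  have key (z : kˣ) (hz : z ^ (q - 1) = 1) : z ^ (q + 1) = z ^ 2 := by
    rw [show q + 1 = q - 1 + 2 by omega, pow_add, hz, one_mul]
  refine Nat.card_congr (Equiv.ofBijective (fun ξ => ⟨ξ.1 g, ?_⟩) ⟨?_, ?_⟩)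
  · obtain ⟨ξ, h1, h2⟩ := ξ
    have h3 : ξ g ^ (q - 1) = 1 := by
      have h := h2 g
      rw [map_pow, show q = q - 1 + 1 by omega, pow_succ, mul_eq_right] at h
      exact h
    exact ⟨by rw [← h1, map_pow, key _ h3], h3⟩
  · intro ξ η h
    refine Subtype.ext (MonoidHom.ext fun x => ?_)
    obtain ⟨n, rfl⟩ := Subgroup.mem_zpowers_iff.mp (hg x)
    rw [map_zpow, map_zpow, show ξ.1 g = η.1 g from congrArg Subtype.val h]
  · rintro ⟨z, h1, h2⟩
    have hd : orderOf z ∣ orderOf g := by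
      rw [orderOf_generator hK hg]
      exact (orderOf_dvd_of_pow_eq_one h2).mul_left _
    have hξ := monoidHomOfForallMemZpowers_apply_gen hg hd
    refine ⟨⟨monoidHomOfForallMemZpowers hg hd, ?_, ?_⟩, Subtype.ext hξ⟩
    · rintro ⟨x, hx⟩
      obtain ⟨n, rfl⟩ := exists_eq_zpow_of_mem_Fsub hq hK hg hx
      rw [map_zpow, map_pow, hξ, key z h2, h1, ← map_zpow]
      rfl
    · intro x
      obtain ⟨n, rfl⟩ := Subgroup.mem_zpowers_iff.mp (hg x)
      rw [map_pow, map_zpow, hξ, show q = q - 1 + 1 by omega, pow_succ, ← zpow_natCast,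
        zpow_comm, zpow_natCast, h2, one_zpow, one_mul]

theorem generator_pow_half {m : ℕ} (hm : 0 < m) (hK : Fintype.card K = (2 * m + 1) ^ 2) {g : Kˣ}
    (hg : ∀ x, x ∈ Subgroup.zpowers g) : (g ^ (2 * m + 1 + 1)) ^ m = -1 := by
  have ho := orderOf_generator hK hg
  rw [Nat.add_sub_cancel] at ho
  have h1 : ((g ^ (2 * m + 1 + 1)) ^ m) ^ 2 = 1 := by
    rw [← pow_mul, ← pow_mul, ← orderOf_dvd_iff_pow_eq_one, ho]
    exact dvd_of_eq (by ring)
  have h2 : (g ^ (2 * m + 1 + 1)) ^ m ≠ 1 := by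
    rw [← pow_mul]
    refine pow_ne_one_of_lt_orderOf (by positivity) ?_
    rw [ho]
    nlinarith
  exact (units_sq_eq_sq_iff.mp (h1.trans (one_pow 2).symm)).resolve_left h2

theorem exists_units_sq_eq [IsAlgClosed k] (c : kˣ) : ∃ z : kˣ, z ^ 2 = c := by
  obtain ⟨z, hz⟩ := IsAlgClosed.exists_pow_nat_eq (c : k) zero_lt_two
  have h0 : z ≠ 0 := by
    rintro rfl
    exact c.ne_zero (by simpa using hz.symm)
  exact ⟨Units.mk0 z h0, Units.ext (by simpa using hz)⟩

theorem units_neg_eq_self [CharP k 2] (z : kˣ) : -z = z :=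
  Units.ext (by rw [Units.val_neg, CharTwo.neg_eq])

theorem units_ne_neg_of_two_ne_zero (h : (2 : k) ≠ 0) (z : kˣ) : z ≠ -z := by
  intro hz
  have hz' : (z : k) = -z := by
    rw [← Units.val_neg]
    exact congrArg Units.val hz
  exact mul_ne_zero h z.ne_zero (by linear_combination hz')

end Helpers

/-- Let `K` be a field with `q²` elements, `Fˣ` the unit group of its `q`-element
subfield, `k` an algebraic closure of `𝔽_p`, and `ω : Fˣ → kˣ` a character.  The number
of irregular characters `ξ : Kˣ → kˣ` extending `ω` (i.e. with `ξ (x^q) = ξ x` for all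
`x`) is `0` if `p ≠ 2` and `ω(-1) ≠ 1`; `2` if `p ≠ 2` and `ω(-1) = 1`; `1` if `p = 2`. -/
theorem stmt11 (p f q : ℕ) (hp : p.Prime) (hf : 0 < f) (hq : q = p ^ f)
    (K : Type) [Field K] [Fintype K] (hK : Fintype.card K = q ^ 2)
    (k : Type) [Field k] [CharP k p] [IsAlgClosed k] (ω : Fsub q K →* kˣ) :
    (p ≠ 2 → ω ⟨-1, neg_one_mem_Fsub hp hf hq hK⟩ ≠ 1 →
      Nat.card {ξ : Kˣ →* kˣ // (∀ x : Fsub q K, ξ ↑x = ω x) ∧ ∀ x : Kˣ, ξ (x ^ q) = ξ x} = 0) ∧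
    (p ≠ 2 → ω ⟨-1, neg_one_mem_Fsub hp hf hq hK⟩ = 1 →
      Nat.card {ξ : Kˣ →* kˣ // (∀ x : Fsub q K, ξ ↑x = ω x) ∧ ∀ x : Kˣ, ξ (x ^ q) = ξ x} = 2) ∧
    (p = 2 →
      Nat.card {ξ : Kˣ →* kˣ // (∀ x : Fsub q K, ξ ↑x = ω x) ∧ ∀ x : Kˣ, ξ (x ^ q) = ξ x} = 1) := by
  obtain ⟨g, hg⟩ := IsCyclic.exists_generator (α := Kˣ)
  have hq1 : 1 < q := hq ▸ Nat.one_lt_pow hf.ne' hp.one_lt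
  rw [card_irregular_extensions hq1 hK hg ω]
  set c := ω ⟨g ^ (q + 1), generator_pow_mem_Fsub hK g⟩ with hc
  have odd_case (hp2 : p ≠ 2) (z : kˣ) (hz : z ^ 2 = c) :
      z ^ (q - 1) = ω ⟨-1, neg_one_mem_Fsub hp hf hq hK⟩ := by
    obtain ⟨m, hm⟩ : Odd q := hq ▸ (hp.odd_of_ne_two hp2).pow
    have h1 : (g ^ (q + 1)) ^ m = -1 := by
      subst hm
      exact generator_pow_half (by omega) hK hg
    rw [show q - 1 = 2 * m by omega, pow_mul, hz, hc, ← map_pow]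
    exact congrArg ω (Subtype.ext h1)
  obtain ⟨w, hw⟩ := exists_units_sq_eq c
  refine ⟨fun hp2 hω => ?_, fun hp2 hω => ?_, fun hp2 => ?_⟩
  · have : IsEmpty {z : kˣ // z ^ 2 = c ∧ z ^ (q - 1) = 1} :=
      ⟨fun z => hω (by rw [← odd_case hp2 z.1 z.2.1, z.2.2])⟩
    exact Nat.card_of_isEmpty
  · have h2 : (2 : k) ≠ 0 := Ring.two_ne_zero (by rwa [ringChar.eq k p])
    have hset : {z : kˣ | z ^ 2 = c ∧ z ^ (q - 1) = 1} = {w, -w} := by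
      ext z
      simp only [Set.mem_ofPred_eq, Set.mem_insert_iff, Set.mem_singleton_iff]
      rw [← units_sq_eq_sq_iff, hw]
      exact ⟨And.left, fun h => ⟨h, (odd_case hp2 z h).trans hω⟩⟩
    change Set.ncard {z : kˣ | z ^ 2 = c ∧ z ^ (q - 1) = 1} = 2
    rw [hset, Set.ncard_pair (units_ne_neg_of_two_ne_zero h2 w)]
  · subst hp2
    have hcq : c ^ (q - 1) = 1 := by
      rw [hc, ← map_pow, ← map_one ω]
      refine congrArg ω (Subtype.ext ?_)
      change (g ^ (q + 1)) ^ (q - 1) = 1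
      rw [← pow_mul, ← orderOf_generator hK hg, pow_orderOf_eq_one]
    have hset : {z : kˣ | z ^ 2 = c ∧ z ^ (q - 1) = 1} = {w} := by
      ext z
      simp only [Set.mem_ofPred_eq, Set.mem_singleton_iff]
      have hinj {a b : kˣ} : a ^ 2 = b ^ 2 ↔ a = b := by
        rw [units_sq_eq_sq_iff, units_neg_eq_self, or_self]
      rw [← hinj (a := z), hw]
      refine ⟨And.left, fun h => ⟨h, hinj.mp ?_⟩⟩
      rw [← pow_mul, mul_comm, pow_mul, h, hcq, one_pow]
    change Set.ncard {z : kˣ | z ^ 2 = c ∧ z ^ (q - 1) = 1} = 1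
    rw [hset, Set.ncard_singleton]
end
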